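/- Let 0 < r < s < ∞ and let X : ℝ⁴ → ℝ⁴ be a continuously differentiable vector field with compact support. For (a,b) ∈ ℝ² with a² + b² = 1 let P₁(a,b) be the span of the orthonormal pair τ₁ = a·e₁ + b·e₂, τ₂ = a·e₃ + b·e₄, and for (c,d) ∈ ℝ² with c² + d² = 1 let P₂(c,d) be the span of the orthonormal pair σ₁ = c·e₁ + d·e₃, σ₂ = c·e₂ + d·e₄. Then ∫_{(a,b) ∈ S¹} ( ∫_{x ∈ P₁(a,b), r ≤ ‖x‖ ≤ s} (⟨τ₁, DX(x)τ₁⟩ + ⟨τ₂, DX(x)τ₂⟩) dℋ²(x) ) dℋ¹(a,b) = ∫_{(c,d) ∈ S¹} ( ∫_{x ∈ P₂(c,d), r ≤ ‖x‖ ≤ s} (⟨σ₁, DX(x)σ₁⟩ + ⟨σ₂, DX(x)σ₂⟩) dℋ²(x) ) dℋ¹(c,d), i.e., the first variations of the two averaged plane varifolds restricted to the annulus {r ≤ ‖x‖ ≤ s} coincide. -/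

import Mathlib

open MeasureTheory
open scoped RealInnerProductSpace

/-- The standard basis vectors of `ℝ⁴` (as a Euclidean space). -/
noncomputable def e (i : Fin 4) : EuclideanSpace ℝ (Fin 4) := EuclideanSpace.single i 1


lemma swap_interval {a b c d : ℝ} (hab : a ≤ b) (hcd : c ≤ d) (f : ℝ → ℝ → ℝ)
    (hf : Continuous (Function.uncurry f)) :
    ∫ x in a..b, ∫ y in c..d, f x y = ∫ y in c..d, ∫ x in a..b, f x y := by
  simp only [intervalIntegral.integral_of_le hab, intervalIntegral.integral_of_le hcd]
  apply integral_integral_swap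
  rw [Measure.prod_restrict]
  exact ((hf.continuousOn.integrableOn_compact (isCompact_Icc.prod isCompact_Icc)).mono_set
    (Set.prod_mono Set.Ioc_subset_Icc_self Set.Ioc_subset_Icc_self))

lemma sphere_finite : IsFiniteMeasure ((μH[1] : Measure ℂ).restrict (Metric.sphere 0 1)) := by
  constructor
  rw [Measure.restrict_apply_univ]
  have h1 : Metric.sphere (0:ℂ) 1 ⊆ circleMap 0 1 '' Set.Icc (-Real.pi) Real.pi := by
    intro z hz
    refine ⟨z.arg, ⟨(Complex.neg_pi_lt_arg z).le, Complex.arg_le_pi z⟩, ?_⟩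
    have := Complex.norm_mul_exp_arg_mul_I z
    rw [mem_sphere_zero_iff_norm.1 hz] at this
    simpa [circleMap] using this
  refine (measure_mono h1).trans_lt ?_
  refine ((lipschitzWith_circleMap 0 1).hausdorffMeasure_image_le zero_le_one _).trans_lt ?_
  rw [hausdorffMeasure_real]
  simp

lemma circle_C : ∃ C : ℝ, ∀ G : ℂ → ℝ, Continuous G →
    ∫ z in Metric.sphere (0:ℂ) 1, G z ∂μH[1] =
      C * ∫ t in (-Real.pi)..Real.pi, G (circleMap 0 1 t) := by
  have := sphere_finite
  set μ := (μH[1] : Measure ℂ).restrict (Metric.sphere 0 1) with hμ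
  refine ⟨(2 * Real.pi)⁻¹ * μ.real Set.univ, fun G hG => ?_⟩
  have hpi := Real.pi_pos
  have rot : ∀ t : ℝ, ∫ z, G (circleMap 0 1 t * z) ∂μ = ∫ z, G z ∂μ := by
    intro t
    let R : ℂ ≃ᵢ ℂ := (rotation (Circle.exp t)).toIsometryEquiv
    have hR : ∀ z, R z = circleMap 0 1 t * z := by
      intro z; simp [R, circleMap, Circle.coe_exp]
    have h := (R.measurePreserving_hausdorffMeasure 1).setIntegral_preimage_emb
      R.toHomeomorph.measurableEmbedding G (Metric.sphere 0 1)
    have hp : R ⁻¹' Metric.sphere 0 1 = Metric.sphere 0 1 := by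
      ext z
      rw [Set.mem_preimage, mem_sphere_zero_iff_norm, mem_sphere_zero_iff_norm, hR]
      simp [circleMap]
    rw [hp] at h
    simpa only [hR] using h
  have per : ∀ z ∈ Metric.sphere (0:ℂ) 1, ∫ t in (-Real.pi)..Real.pi, G (circleMap 0 1 t * z)
      = ∫ t in (-Real.pi)..Real.pi, G (circleMap 0 1 t) := by
    intro z hz
    have hz' : z = circleMap 0 1 z.arg := by
      have := Complex.norm_mul_exp_arg_mul_I z
      rw [mem_sphere_zero_iff_norm.1 hz] at this
      simpa [circleMap] using this.symm
    have : ∀ t, circleMap 0 1 t * z = circleMap 0 1 (t + z.arg) := by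
      intro t; conv_lhs => rw [hz']
      simp [circleMap, add_mul, Complex.exp_add]
    simp only [this]
    rw [intervalIntegral.integral_comp_add_right (fun t => G (circleMap 0 1 t))]
    have hP : Function.Periodic (fun t => G (circleMap 0 1 t)) (2 * Real.pi) := by
      intro t; simp only; rw [periodic_circleMap 0 1 t]
    have := hP.intervalIntegral_add_eq (-Real.pi + z.arg) (-Real.pi)
    convert this using 2 <;> ring
  have fub : ∫ t in (-Real.pi)..Real.pi, ∫ z, G (circleMap 0 1 t * z) ∂μ
      = ∫ z, (∫ t in (-Real.pi)..Real.pi, G (circleMap 0 1 t * z)) ∂μ := by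
    apply intervalIntegral_integral_swap
    obtain ⟨M, hM⟩ := (isCompact_sphere (0:ℂ) 1).exists_bound_of_continuousOn hG.continuousOn
    have hc : Continuous (fun p : ℝ × ℂ => G (circleMap 0 1 p.1 * p.2)) := by fun_prop
    have : IsFiniteMeasure (volume.restrict (Set.uIoc (-Real.pi) Real.pi)) :=
      ⟨by simp [Set.uIoc]⟩
    refine Integrable.of_bound hc.aestronglyMeasurable M ?_
    have hae : ∀ᵐ z ∂μ, z ∈ Metric.sphere (0:ℂ) 1 :=
      ae_restrict_mem Metric.isClosed_sphere.measurableSet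
    refine (Measure.quasiMeasurePreserving_snd.ae hae).mono ?_
    rintro ⟨t, z⟩ hz
    apply hM
    simpa [circleMap] using hz
  have e2 : ∫ z, (∫ t in (-Real.pi)..Real.pi, G (circleMap 0 1 t * z)) ∂μ
      = ∫ z, (∫ t in (-Real.pi)..Real.pi, G (circleMap 0 1 t)) ∂μ :=
    setIntegral_congr_fun Metric.isClosed_sphere.measurableSet per
  rw [e2] at fub
  simp only [rot, intervalIntegral.integral_const, integral_const, smul_eq_mul] at fub
  rw [mul_assoc, ← fub]
  field_simp
  ring

lemma circle_E : ∃ C : ℝ, ∀ G : EuclideanSpace ℝ (Fin 2) → ℝ, Continuous G →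
    ∫ z in Metric.sphere (0:EuclideanSpace ℝ (Fin 2)) 1, G z ∂μH[1] =
      C * ∫ t in (-Real.pi)..Real.pi, G !₂[Real.cos t, Real.sin t] := by
  obtain ⟨C, hC⟩ := circle_C
  refine ⟨C, fun G hG => ?_⟩
  let R : ℂ ≃ᵢ EuclideanSpace ℝ (Fin 2) := Complex.orthonormalBasisOneI.repr.toIsometryEquiv
  have h := (R.measurePreserving_hausdorffMeasure 1).setIntegral_preimage_emb
      R.toHomeomorph.measurableEmbedding G (Metric.sphere 0 1)
  have hp : R ⁻¹' Metric.sphere 0 1 = Metric.sphere 0 1 := by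
    ext z; simp [R]
  rw [hp] at h
  rw [← h, hC (fun z => G (R z)) (hG.comp R.continuous)]
  congr 1
  apply intervalIntegral.integral_congr
  intro t _
  simp only
  congr 1
  ext i
  fin_cases i <;> simp [R, circleMap, Complex.exp_ofReal_mul_I_re, Complex.exp_ofReal_mul_I_im]

lemma haus_C : ∃ c : ℝ, ∀ f : ℂ → ℝ, ∫ z, f z ∂μH[2] = c * ∫ z, f z := by
  have : (μH[2] : Measure ℂ).IsAddHaarMeasure := by
    simpa using MeasureTheory.isAddHaarMeasure_hausdorffMeasure (E := ℂ)
  refine ⟨(Measure.addHaarScalarFactor (μH[2] : Measure ℂ) volume : ℝ), fun f => ?_⟩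
  conv_lhs => rw [Measure.isAddLeftInvariant_eq_smul (μH[2] : Measure ℂ) volume]
  rw [integral_smul_nnreal_measure]
  rfl

lemma plane_int (r s : ℝ) (hr : 0 < r) (hrs : r < s) : ∃ C : ℝ,
    ∀ (v w : EuclideanSpace ℝ (Fin 4)) (f : EuclideanSpace ℝ (Fin 4) → ℝ),
    ‖v‖ = 1 → ‖w‖ = 1 → ⟪v, w⟫ = 0 → Continuous f →
    ∫ x in {x : EuclideanSpace ℝ (Fin 4) | x ∈ Submodule.span ℝ
        ({v, w} : Set (EuclideanSpace ℝ (Fin 4))) ∧ r ≤ ‖x‖ ∧ ‖x‖ ≤ s}, f x ∂μH[2]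
    = C * ∫ ρ in r..s, ∫ t in (-Real.pi)..Real.pi,
        ρ * f ((ρ * Real.cos t) • v + (ρ * Real.sin t) • w) := by
  obtain ⟨c, hc⟩ := haus_C
  refine ⟨c, fun v w f hv hw hvw hf => ?_⟩
  let L : ℂ →ₗ[ℝ] EuclideanSpace ℝ (Fin 4) :=
    Complex.reLm.smulRight v + Complex.imLm.smulRight w
  have hL : ∀ z, L z = z.re • v + z.im • w := fun z => by simp [L]
  have hn : ∀ z, ‖L z‖ = ‖z‖ := by
    intro z
    rw [← sq_eq_sq₀ (norm_nonneg _) (norm_nonneg _), hL, norm_add_sq_real, norm_smul, norm_smul,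
      inner_smul_left, inner_smul_right, hvw, hv, hw, Complex.sq_norm, Complex.normSq_apply]
    simp; ring
  let Li : ℂ →ₗᵢ[ℝ] EuclideanSpace ℝ (Fin 4) := ⟨L, hn⟩
  have hLi : ∀ z, Li z = z.re • v + z.im • w := hL
  have hr' : Set.range Li = (Submodule.span ℝ {v, w} : Set (EuclideanSpace ℝ (Fin 4))) := by
    ext x
    rw [SetLike.mem_coe, Submodule.mem_span_pair]
    constructor
    · rintro ⟨z, rfl⟩; exact ⟨z.re, z.im, (hLi z).symm⟩
    · rintro ⟨a, b, rfl⟩; exact ⟨⟨a, b⟩, hLi _⟩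
  have hmap := Li.isometry.map_hausdorffMeasure (d := 2) (Or.inl zero_le_two)
  have hA : MeasurableSet {x : EuclideanSpace ℝ (Fin 4) | r ≤ ‖x‖ ∧ ‖x‖ ≤ s} :=
    ((isClosed_le continuous_const continuous_norm).inter
      (isClosed_le continuous_norm continuous_const)).measurableSet
  have hset : {x : EuclideanSpace ℝ (Fin 4) | x ∈ Submodule.span ℝ
        ({v, w} : Set (EuclideanSpace ℝ (Fin 4))) ∧ r ≤ ‖x‖ ∧ ‖x‖ ≤ s} =
      {x : EuclideanSpace ℝ (Fin 4) | r ≤ ‖x‖ ∧ ‖x‖ ≤ s} ∩ Set.range Li := by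
    rw [hr']; ext x; simp [and_comm]
  rw [hset, ← Measure.restrict_restrict hA, ← hmap,
    Li.isometry.isClosedEmbedding.setIntegral_map]
  have hB : MeasurableSet (Li ⁻¹' {x : EuclideanSpace ℝ (Fin 4) | r ≤ ‖x‖ ∧ ‖x‖ ≤ s}) :=
    Li.continuous.measurable hA
  rw [← integral_indicator hB, hc, ← Complex.integral_comp_polarCoord_symm]
  congr 1
  have hsub : Set.Icc r s ×ˢ Set.Ioo (-Real.pi) Real.pi ⊆ polarCoord.target := by
    rintro ⟨a, b⟩ ⟨ha, hb⟩
    exact ⟨hr.trans_le ha.1, hb⟩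
  rw [intervalIntegral.integral_of_le hrs.le, ← integral_Icc_eq_integral_Ioc]
  simp only [intervalIntegral.integral_of_le (neg_le_self Real.pi_pos.le),
    integral_Ioc_eq_integral_Ioo]
  have hcont : Continuous (fun p : ℝ × ℝ =>
    p.1 * f ((p.1 * Real.cos p.2) • v + (p.1 * Real.sin p.2) • w)) := by fun_prop
  have hI : IntegrableOn (fun p : ℝ × ℝ =>
    p.1 * f ((p.1 * Real.cos p.2) • v + (p.1 * Real.sin p.2) • w))
      (Set.Icc r s ×ˢ Set.Ioo (-Real.pi) Real.pi) (volume.prod volume) :=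
    (hcont.continuousOn.integrableOn_compact (isCompact_Icc.prod isCompact_Icc)).mono_set
      (Set.prod_mono le_rfl Set.Ioo_subset_Icc_self)
  rw [← setIntegral_prod _ hI, ← Measure.volume_eq_prod,
    setIntegral_eq_of_subset_of_forall_sdiff_eq_zero
      polarCoord.open_target.measurableSet hsub]
  · apply setIntegral_congr_fun (measurableSet_Icc.prod measurableSet_Ioo)
    rintro ⟨a, b⟩ ⟨ha, hb⟩
    have ha0 : 0 < a := hr.trans_le ha.1
    simp only [smul_eq_mul]
    rw [Set.indicator_of_mem]
    · rw [hLi]; simp [Complex.polarCoord_symm_apply, -Complex.ofReal_cos, -Complex.ofReal_sin]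
    · simp only [Set.mem_preimage, Set.mem_ofPred_eq, Li.norm_map, Complex.norm_polarCoord_symm,
        abs_of_pos ha0]
      exact ha
  · rintro ⟨a, b⟩ ⟨⟨ha, hb⟩, hn⟩
    rw [Set.indicator_of_notMem, smul_zero]
    intro h
    simp only [Set.mem_preimage, Set.mem_ofPred_eq, Li.norm_map, Complex.norm_polarCoord_symm] at h
    rw [abs_of_pos ha] at h
    exact hn ⟨h, hb⟩

lemma inner_ibp (X : EuclideanSpace ℝ (Fin 4) → EuclideanSpace ℝ (Fin 4))
    (hX : ContDiff ℝ 1 X) (v w : EuclideanSpace ℝ (Fin 4)) (ρ : ℝ) :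
    ∫ t in (-Real.pi)..Real.pi,
      ρ * (⟪v, fderiv ℝ X ((ρ * Real.cos t) • v + (ρ * Real.sin t) • w) v⟫
        + ⟪w, fderiv ℝ X ((ρ * Real.cos t) • v + (ρ * Real.sin t) • w) w⟫)
    = ∫ t in (-Real.pi)..Real.pi,
      (ρ * ⟪Real.cos t • v + Real.sin t • w,
          fderiv ℝ X (ρ • (Real.cos t • v + Real.sin t • w)) (Real.cos t • v + Real.sin t • w)⟫
        + ⟪X (ρ • (Real.cos t • v + Real.sin t • w)), Real.cos t • v + Real.sin t • w⟫) := by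
  have hD : Continuous (fderiv ℝ X) := hX.continuous_fderiv one_ne_zero
  have hXc : Continuous X := hX.continuous
  have hpt : ∀ t : ℝ, (ρ * Real.cos t) • v + (ρ * Real.sin t) • w
      = ρ • (Real.cos t • v + Real.sin t • w) := fun t => by
    rw [smul_add, smul_smul, smul_smul]
  simp only [hpt]
  rw [← sub_eq_zero, ← intervalIntegral.integral_sub
    (Continuous.intervalIntegrable (by fun_prop) _ _)
    (Continuous.intervalIntegrable (by fun_prop) _ _)]
  have hy : ∀ t : ℝ, HasDerivAt (fun t : ℝ => Real.cos t • v + Real.sin t • w)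
      ((-Real.sin t) • v + Real.cos t • w) t := fun t =>
    ((Real.hasDerivAt_cos t).smul_const v).add ((Real.hasDerivAt_sin t).smul_const w)
  have hy' : ∀ t : ℝ, HasDerivAt (fun t : ℝ => (-Real.sin t) • v + Real.cos t • w)
      ((-Real.cos t) • v + (-Real.sin t) • w) t := fun t =>
    ((Real.hasDerivAt_sin t).neg.smul_const v).add ((Real.hasDerivAt_cos t).smul_const w)
  have hder : ∀ t ∈ Set.uIcc (-Real.pi) Real.pi, HasDerivAt
      (fun t : ℝ => ⟪X (ρ • (Real.cos t • v + Real.sin t • w)),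
        (-Real.sin t) • v + Real.cos t • w⟫)
      (ρ * (⟪v, fderiv ℝ X (ρ • (Real.cos t • v + Real.sin t • w)) v⟫
        + ⟪w, fderiv ℝ X (ρ • (Real.cos t • v + Real.sin t • w)) w⟫)
       - (ρ * ⟪Real.cos t • v + Real.sin t • w,
          fderiv ℝ X (ρ • (Real.cos t • v + Real.sin t • w)) (Real.cos t • v + Real.sin t • w)⟫
        + ⟪X (ρ • (Real.cos t • v + Real.sin t • w)), Real.cos t • v + Real.sin t • w⟫)) t := by
    intro t _
    have h1 := ((hX.differentiable one_ne_zero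
      (ρ • (Real.cos t • v + Real.sin t • w))).hasFDerivAt.comp_hasDerivAt t
        ((hy t).const_smul ρ))
    have h2 := h1.inner ℝ (hy' t)
    refine h2.congr_deriv ?_
    have e1 : Real.cos t ^ 2 = 1 - Real.sin t ^ 2 := by
      linarith [Real.sin_sq_add_cos_sq t]
    simp only [Function.comp]
    rw [real_inner_comm ((-Real.sin t) • v + Real.cos t • w)]
    generalize fderiv ℝ X (ρ • (Real.cos t • v + Real.sin t • w)) = D
    generalize X (ρ • (Real.cos t • v + Real.sin t • w)) = Z
    simp only [map_add, map_smul, inner_add_left, inner_add_right, inner_smul_left,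
      inner_smul_right, RCLike.conj_to_real]
    ring_nf
    rw [e1]
    ring
  rw [intervalIntegral.integral_eq_sub_of_hasDerivAt hder
    (Continuous.intervalIntegrable (by fun_prop) _ _)]
  simp

lemma cont_param {Y : Type*} [TopologicalSpace Y] (f : Y → ℝ → ℝ)
    (hf : Continuous (Function.uncurry f)) (a b : ℝ) :
    Continuous fun x => ∫ t in a..b, f x t :=
  intervalIntegral.continuous_parametric_intervalIntegral_of_continuous' hf a b

lemma side (r s : ℝ) (hr : 0 < r) (hrs : r < s) : ∃ C : ℝ,
    ∀ (X : EuclideanSpace ℝ (Fin 4) → EuclideanSpace ℝ (Fin 4)) (_ : ContDiff ℝ 1 X)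
    (a b c d : EuclideanSpace ℝ (Fin 4)),
    (∀ p : EuclideanSpace ℝ (Fin 2), ‖p‖ = 1 → ‖p 0 • a + p 1 • b‖ = 1 ∧
      ‖p 0 • c + p 1 • d‖ = 1 ∧ ⟪p 0 • a + p 1 • b, p 0 • c + p 1 • d⟫ = 0) →
    (∫ p in Metric.sphere (0 : EuclideanSpace ℝ (Fin 2)) 1,
      (∫ x in {x : EuclideanSpace ℝ (Fin 4) |
            x ∈ Submodule.span ℝ
              ({p 0 • a + p 1 • b, p 0 • c + p 1 • d} :
                Set (EuclideanSpace ℝ (Fin 4))) ∧ r ≤ ‖x‖ ∧ ‖x‖ ≤ s},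
          (⟪p 0 • a + p 1 • b, fderiv ℝ X x (p 0 • a + p 1 • b)⟫ +
           ⟪p 0 • c + p 1 • d, fderiv ℝ X x (p 0 • c + p 1 • d)⟫) ∂μH[2]) ∂μH[1])
    = C * ∫ ρ in r..s, ∫ θ in (-Real.pi)..Real.pi, ∫ t in (-Real.pi)..Real.pi,
      (fun y => ρ * ⟪y, fderiv ℝ X (ρ • y) y⟫ + ⟪X (ρ • y), y⟫)
        (Real.cos t • (Real.cos θ • a + Real.sin θ • b)
          + Real.sin t • (Real.cos θ • c + Real.sin θ • d)) := by
  obtain ⟨C₁, h₁⟩ := circle_E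
  obtain ⟨C₂, h₂⟩ := plane_int r s hr hrs
  refine ⟨C₁ * C₂, fun X hX a b c d hon => ?_⟩
  have hD : Continuous (fderiv ℝ X) := hX.continuous_fderiv one_ne_zero
  have hXc : Continuous X := hX.continuous
  let H : ℝ → EuclideanSpace ℝ (Fin 4) → ℝ :=
    fun ρ y => ρ * ⟪y, fderiv ℝ X (ρ • y) y⟫ + ⟪X (ρ • y), y⟫
  have hH : Continuous (fun q : ℝ × EuclideanSpace ℝ (Fin 4) => H q.1 q.2) := by
    simp only [H]; fun_prop
  let G : EuclideanSpace ℝ (Fin 2) → ℝ := fun p => C₂ * ∫ ρ in r..s,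
    ∫ t in (-Real.pi)..Real.pi,
      H ρ (Real.cos t • (p 0 • a + p 1 • b) + Real.sin t • (p 0 • c + p 1 • d))
  have hG : Continuous G := by
    refine continuous_const.mul (cont_param _ ?_ _ _)
    refine cont_param (fun (q : EuclideanSpace ℝ (Fin 2) × ℝ) t => H q.2
      (Real.cos t • (q.1 0 • a + q.1 1 • b) + Real.sin t • (q.1 0 • c + q.1 1 • d))) ?_ _ _
    exact hH.comp (f := fun q : (EuclideanSpace ℝ (Fin 2) × ℝ) × ℝ => (q.1.2,
      (Real.cos q.2 • (q.1.1 0 • a + q.1.1 1 • b) + Real.sin q.2 • (q.1.1 0 • c + q.1.1 1 • d))))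
      (by fun_prop)
  have hin : Set.EqOn (fun p : EuclideanSpace ℝ (Fin 2) => (∫ x in {x : EuclideanSpace ℝ (Fin 4) |
            x ∈ Submodule.span ℝ
              ({p 0 • a + p 1 • b, p 0 • c + p 1 • d} :
                Set (EuclideanSpace ℝ (Fin 4))) ∧ r ≤ ‖x‖ ∧ ‖x‖ ≤ s},
          (⟪p 0 • a + p 1 • b, fderiv ℝ X x (p 0 • a + p 1 • b)⟫ +
           ⟪p 0 • c + p 1 • d, fderiv ℝ X x (p 0 • c + p 1 • d)⟫) ∂μH[2])) G
      (Metric.sphere 0 1) := by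
    intro p hp
    obtain ⟨n1, n2, n3⟩ := hon p (mem_sphere_zero_iff_norm.1 hp)
    simp only [G]
    rw [h₂ _ _ _ n1 n2 n3 (by fun_prop)]
    simp only [inner_ibp X hX, H]
  rw [setIntegral_congr_fun Metric.isClosed_sphere.measurableSet hin, h₁ G hG]
  simp only [G]
  rw [intervalIntegral.integral_const_mul, mul_assoc]
  congr 2
  rw [swap_interval (neg_le_self Real.pi_pos.le) hrs.le]
  · simp [H]
  · refine cont_param (fun (q : ℝ × ℝ) t => H q.2
      (Real.cos t • ((!₂[Real.cos q.1, Real.sin q.1] : EuclideanSpace ℝ (Fin 2)) 0 • a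
        + (!₂[Real.cos q.1, Real.sin q.1] : EuclideanSpace ℝ (Fin 2)) 1 • b)
       + Real.sin t • ((!₂[Real.cos q.1, Real.sin q.1] : EuclideanSpace ℝ (Fin 2)) 0 • c
        + (!₂[Real.cos q.1, Real.sin q.1] : EuclideanSpace ℝ (Fin 2)) 1 • d))) ?_ _ _
    simp only [Matrix.cons_val_zero, Matrix.cons_val_one, PiLp.toLp_apply]
    exact hH.comp (f := fun q : (ℝ × ℝ) × ℝ => (q.1.2,
      (Real.cos q.2 • (Real.cos q.1.1 • a + Real.sin q.1.1 • b)
        + Real.sin q.2 • (Real.cos q.1.1 • c + Real.sin q.1.1 • d))))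
      (by fun_prop)

lemma e_inner (i j : Fin 4) : ⟪e i, e j⟫ = if i = j then (1:ℝ) else 0 := by
  simp [e, EuclideanSpace.inner_single_left, Pi.single_apply, eq_comm]

lemma e_frame (i j k l : Fin 4) (hij : i ≠ j) (hkl : k ≠ l) (hik : i ≠ k) (hil : i ≠ l)
    (hjk : j ≠ k) (hjl : j ≠ l) (p : EuclideanSpace ℝ (Fin 2)) (hp : ‖p‖ = 1) :
    ‖p 0 • e i + p 1 • e j‖ = 1 ∧
      ‖p 0 • e k + p 1 • e l‖ = 1 ∧ ⟪p 0 • e i + p 1 • e j, p 0 • e k + p 1 • e l⟫ = 0 := by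
  have h : p 0 * p 0 + p 1 * p 1 = 1 := by
    have := EuclideanSpace.real_norm_sq_eq p
    rw [hp, Fin.sum_univ_two] at this
    nlinarith
  have key : ∀ i j : Fin 4, i ≠ j → ‖p 0 • e i + p 1 • e j‖ = 1 := by
    intro i j hij
    rw [← sq_eq_sq₀ (norm_nonneg _) zero_le_one, ← real_inner_self_eq_norm_sq]
    rw [inner_add_left, inner_add_right, inner_add_right]
    simp only [inner_smul_left, inner_smul_right, e_inner, hij, hij.symm, if_true, if_false,
      RCLike.conj_to_real]
    linarith
  refine ⟨key i j hij, key k l hkl, ?_⟩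
  simp [inner_add_left, inner_add_right, inner_smul_left, inner_smul_right, e_inner, hik, hil,
    hjk, hjl]

theorem stmt_7 (r s : ℝ) (hr : 0 < r) (hrs : r < s)
    (X : EuclideanSpace ℝ (Fin 4) → EuclideanSpace ℝ (Fin 4))
    (hX : ContDiff ℝ 1 X) (hXc : HasCompactSupport X) :
    (∫ p in Metric.sphere (0 : EuclideanSpace ℝ (Fin 2)) 1,
      (∫ x in {x : EuclideanSpace ℝ (Fin 4) |
            x ∈ Submodule.span ℝ
              ({p 0 • e 0 + p 1 • e 1, p 0 • e 2 + p 1 • e 3} :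
                Set (EuclideanSpace ℝ (Fin 4))) ∧ r ≤ ‖x‖ ∧ ‖x‖ ≤ s},
          (⟪p 0 • e 0 + p 1 • e 1, fderiv ℝ X x (p 0 • e 0 + p 1 • e 1)⟫ +
           ⟪p 0 • e 2 + p 1 • e 3, fderiv ℝ X x (p 0 • e 2 + p 1 • e 3)⟫) ∂μH[2]) ∂μH[1])
    = ∫ q in Metric.sphere (0 : EuclideanSpace ℝ (Fin 2)) 1,
      (∫ x in {x : EuclideanSpace ℝ (Fin 4) |
            x ∈ Submodule.span ℝ
              ({q 0 • e 0 + q 1 • e 2, q 0 • e 1 + q 1 • e 3} :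
                Set (EuclideanSpace ℝ (Fin 4))) ∧ r ≤ ‖x‖ ∧ ‖x‖ ≤ s},
          (⟪q 0 • e 0 + q 1 • e 2, fderiv ℝ X x (q 0 • e 0 + q 1 • e 2)⟫ +
           ⟪q 0 • e 1 + q 1 • e 3, fderiv ℝ X x (q 0 • e 1 + q 1 • e 3)⟫) ∂μH[2]) ∂μH[1] := by
  have hD : Continuous (fderiv ℝ X) := hX.continuous_fderiv one_ne_zero
  have hXc' : Continuous X := hX.continuous
  obtain ⟨C, hC⟩ := side r s hr hrs
  rw [hC X hX (e 0) (e 1) (e 2) (e 3)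
      (e_frame 0 1 2 3 (by decide) (by decide) (by decide) (by decide) (by decide) (by decide)),
    hC X hX (e 0) (e 2) (e 1) (e 3)
      (e_frame 0 2 1 3 (by decide) (by decide) (by decide) (by decide) (by decide) (by decide))]
  congr 1
  apply intervalIntegral.integral_congr
  intro ρ _
  simp only
  rw [swap_interval (neg_le_self Real.pi_pos.le) (neg_le_self Real.pi_pos.le)]
  · apply intervalIntegral.integral_congr
    intro t _
    apply intervalIntegral.integral_congr
    intro θ _
    have hy : Real.cos t • (Real.cos θ • e 0 + Real.sin θ • e 1)
          + Real.sin t • (Real.cos θ • e 2 + Real.sin θ • e 3)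
        = Real.cos θ • (Real.cos t • e 0 + Real.sin t • e 2)
          + Real.sin θ • (Real.cos t • e 1 + Real.sin t • e 3) := by
      module
    simp only [hy]
  · simp only [Function.uncurry_def]
    fun_prop
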